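/- arXiv:2102.09774 — 7 statements merged into one kernel-verified Lean document; each statement's English description precedes it below -/
import Mathlib

section
/- Fix a transmission error probability p ∈ (0,1) and a user weight w > 0. For every real δ ≥ 1, the Whittle index I(δ) := (1/2)·w·δ·(1−p)·(δ + (1+p)/(1−p)) is the unique real number C such that the threshold policies with thresholds δ and δ+1 have equal average Lagrangian cost, i.e. L(C, δ) = L(C, δ+1). -/
/-- For error probability `p ∈ (0,1)`, weight `w > 0` and age `δ ≥ 1`, the
Whittle index `I(δ) = (1/2)·w·δ·(1−p)·(δ + (1+p)/(1−p))` is the unique cost `C` making the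
average Lagrangian costs of the threshold-`δ` and threshold-`(δ+1)` policies equal, where
`L(C,Γ) = (w·Γ(Γ−1)/2 + (w·Γ + C)/(1−p) + w·p/(1−p)²)/(Γ + p/(1−p))`. -/
theorem whittle_index_unique_cost
    (p w δ : ℝ) (hp0 : 0 < p) (hp1 : p < 1) (hw : 0 < w) (hδ : 1 ≤ δ)
    (L : ℝ → ℝ → ℝ)
    (hL : ∀ C Γ : ℝ, L C Γ =
      (w * Γ * (Γ - 1) / 2 + (w * Γ + C) / (1 - p) + w * p / (1 - p) ^ 2)
        / (Γ + p / (1 - p))) :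
    ∀ C : ℝ, L C δ = L C (δ + 1) ↔
      C = (1 / 2) * w * δ * (1 - p) * (δ + (1 + p) / (1 - p)) := by
  intro C
  have h1 : 0 < 1 - p := by linarith
  have hq : 0 < p / (1 - p) := div_pos hp0 h1
  have hD : δ + p / (1 - p) ≠ 0 := by positivity
  have hD' : δ + 1 + p / (1 - p) ≠ 0 := by positivity
  rw [hL, hL, div_eq_div_iff hD hD', ← sub_eq_zero, ← sub_eq_zero (a := C)]
  have key : (w * δ * (δ - 1) / 2 + (w * δ + C) / (1 - p) + w * p / (1 - p) ^ 2)
        * (δ + 1 + p / (1 - p))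
      - (w * (δ + 1) * (δ + 1 - 1) / 2 + (w * (δ + 1) + C) / (1 - p) + w * p / (1 - p) ^ 2)
        * (δ + p / (1 - p))
      = (1 - p)⁻¹ * (C - (1 / 2) * w * δ * (1 - p) * (δ + (1 + p) / (1 - p))) := by
    have h2 : 1 - p ≠ 0 := h1.ne'
    field_simp
    ring
  rw [key]
  simp [h1.ne']
end

section
/- Fix a transmission error probability p ∈ (0,1) and a transmission cost C ≥ 0. The function Γ ↦ L(C,Γ) = ( Γ(Γ−1)/2 + (C+Γ)/(1−p) + p/(1−p)² ) / ( Γ + p/(1−p) ) is convex on the interval (0, ∞). -/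
/-- For `p ∈ (0,1)` and transmission cost `C ≥ 0`, the average Lagrangian cost
`Γ ↦ L(C,Γ) = (Γ(Γ−1)/2 + (C+Γ)/(1−p) + p/(1−p)²)/(Γ + p/(1−p))` is convex on `(0,∞)`. -/
theorem lagrangian_cost_convex
    (p C : ℝ) (hp0 : 0 < p) (hp1 : p < 1) (hC : 0 ≤ C) :
    ConvexOn ℝ (Set.Ioi (0 : ℝ)) (fun Γ : ℝ =>
      (Γ * (Γ - 1) / 2 + (C + Γ) / (1 - p) + p / (1 - p) ^ 2) / (Γ + p / (1 - p))) := by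
  have hq : 0 < 1 - p := by linarith
  obtain ⟨a, ha⟩ : ∃ a, a = p / (1 - p) := ⟨_, rfl⟩
  have ha0 : 0 < a := by rw [ha]; positivity
  have hb : 1 / (1 - p) = 1 + a := by rw [ha]; field_simp; ring
  have key : ∀ x : ℝ, 0 < x →
      (x * (x - 1) / 2 + (C + x) / (1 - p) + p / (1 - p) ^ 2) / (x + p / (1 - p))
        = (x + a) / 2 + 1 / 2 + (a * (a + 1) / 2 + C * (1 + a)) * (x + a)⁻¹ := by
    intro x hx
    have h1 : (C + x) / (1 - p) = (C + x) * (1 + a) := by rw [← hb]; ring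
    have h2 : p / (1 - p) ^ 2 = a * (1 + a) := by rw [← hb, ha]; field_simp
    have h3 : x + a ≠ 0 := by positivity
    rw [h1, h2, ← ha]
    field_simp
    ring
  have hinv : ConvexOn ℝ (Set.Ioi (0 : ℝ)) (fun x : ℝ => x ^ (-1 : ℤ)) := convexOn_zpow (-1)
  refine ⟨convex_Ioi 0, ?_⟩
  intro x hx y hy s t hs ht hst
  have hxy := convex_Ioi (0 : ℝ) hx hy hs ht hst
  simp only [Set.mem_Ioi] at hx hy hxy
  have h := hinv.2 (x := x + a) (y := y + a) (Set.mem_Ioi.2 (by linarith))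
    (Set.mem_Ioi.2 (by linarith)) hs ht hst
  simp only []
  rw [key _ hx, key _ hy, key _ hxy]
  simp only [zpow_neg_one, smul_eq_mul] at h ⊢
  have e : s * (x + a) + t * (y + a) = s * x + t * y + a := by
    linear_combination a * hst
  rw [e] at h
  have hK : 0 ≤ a * (a + 1) / 2 + C * (1 + a) := by positivity
  have h' := mul_le_mul_of_nonneg_left h hK
  have ht' : t = 1 - s := by linarith
  subst ht'
  linarith
end

section
/- Fix a transmission error probability p ∈ (0,1) and a transmission cost C > 0. Let Γ* := ( √(2C(1−p)+p) − p ) / (1−p). Then Γ* > 0, and for every real Γ > 0 one has L(C, Γ) ≥ L(C, Γ*); that is, Γ* minimizes the average Lagrangian cost over all positive real thresholds. -/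
/-- For `p ∈ (0,1)` and `C > 0`, the threshold
`Γ* = (√(2C(1−p)+p) − p)/(1−p)` is positive and minimizes the average Lagrangian cost
`L(C,Γ) = (Γ(Γ−1)/2 + (C+Γ)/(1−p) + p/(1−p)²)/(Γ + p/(1−p))` over all positive real
thresholds. -/
theorem optimal_threshold_minimizes
    (p C : ℝ) (hp0 : 0 < p) (hp1 : p < 1) (hC : 0 < C)
    (L : ℝ → ℝ → ℝ)
    (hL : ∀ c Γ : ℝ, L c Γ =
      (Γ * (Γ - 1) / 2 + (c + Γ) / (1 - p) + p / (1 - p) ^ 2) / (Γ + p / (1 - p))) :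
    0 < (Real.sqrt (2 * C * (1 - p) + p) - p) / (1 - p) ∧
      ∀ Γ : ℝ, 0 < Γ →
        L C ((Real.sqrt (2 * C * (1 - p) + p) - p) / (1 - p)) ≤ L C Γ := by
  have hq : 0 < 1 - p := by linarith
  have hCq : 0 < C * (1 - p) := mul_pos hC hq
  have hs2 : Real.sqrt (2 * C * (1 - p) + p) ^ 2 = 2 * C * (1 - p) + p :=
    Real.sq_sqrt (by linarith)
  have hps : p < Real.sqrt (2 * C * (1 - p) + p) := by
    apply Real.lt_sqrt_of_sq_lt
    nlinarith
  generalize Real.sqrt (2 * C * (1 - p) + p) = s at hs2 hps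
  have hpos : 0 < (s - p) / (1 - p) := div_pos (by linarith) hq
  have key : ∀ Γ : ℝ, 0 < Γ → L C Γ = 1 / 2 + s / (1 - p) +
      (Γ - (s - p) / (1 - p)) ^ 2 / (2 * (Γ + p / (1 - p))) := by
    intro Γ hΓ
    have hx : 0 < Γ + p / (1 - p) := by positivity
    have hCe : C = (s ^ 2 - p) / (2 * (1 - p)) := by
      field_simp
      linarith
    rw [hL, div_eq_iff hx.ne', add_mul,
      show (Γ - (s - p) / (1 - p)) ^ 2 / (2 * (Γ + p / (1 - p))) * (Γ + p / (1 - p))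
        = (Γ - (s - p) / (1 - p)) ^ 2 / 2 by
          generalize Γ + p / (1 - p) = x at hx
          field_simp, hCe]
    field_simp
    ring
  refine ⟨hpos, fun Γ hΓ => ?_⟩
  rw [key _ hpos, key Γ hΓ, sub_self]
  have : 0 ≤ (Γ - (s - p) / (1 - p)) ^ 2 / (2 * (Γ + p / (1 - p))) := by positivity
  simpa using this
end

section
/- Let M ≥ 1, let w₁,…,w_M > 0 be weights, let p₁,…,p_M ∈ (0,1) be error probabilities, and let λ > 0. For all positive reals λ₁,…,λ_M with λ₁+⋯+λ_M = λ, one has ∑_{j=1}^M w_j · ( (1/λ_j² + p_j) / ( 2(1−p_j)/λ_j ) + 1/2 ) ≥ (1/(2λ)) · ( ∑_{j=1}^M √( w_j/(1−p_j) ) )² + (λ/2) · min_{1 ≤ j ≤ M} ( w_j p_j / (1−p_j) ) + (1/2) ∑_{j=1}^M w_j. (This is the analytic core of the closed-form lower bound on the weighted average AoI for the multi-user standard-ARQ problem under an average transmission constraint.) -/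
open Finset

/-- Analytic core of the closed-form lower bound on the weighted average AoI
for the multi-user standard-ARQ problem under an average transmission constraint. -/
theorem arq_aoi_lower_bound
    (m : ℕ) (w p : Fin (m + 1) → ℝ) (lamTot : ℝ)
    (hw : ∀ j, 0 < w j) (hp0 : ∀ j, 0 < p j) (hp1 : ∀ j, p j < 1)
    (hlam : 0 < lamTot) :
    ∀ lam : Fin (m + 1) → ℝ, (∀ j, 0 < lam j) → (∑ j, lam j) = lamTot →
      ∑ j, w j * ((1 / (lam j) ^ 2 + p j) / (2 * (1 - p j) / lam j) + 1 / 2) ≥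
        (1 / (2 * lamTot)) * (∑ j, Real.sqrt (w j / (1 - p j))) ^ 2 +
          (lamTot / 2) *
            (Finset.univ.inf' Finset.univ_nonempty fun j => w j * p j / (1 - p j)) +
          (1 / 2) * ∑ j, w j := by
  intro lam hl hsum
  have h1 := Finset.sq_sum_div_le_sum_sq_div Finset.univ
    (fun j => Real.sqrt (w j / (1 - p j))) (g := lam) (fun j _ => hl j)
  rw [hsum] at h1
  set c := Finset.univ.inf' Finset.univ_nonempty fun j => w j * p j / (1 - p j) with hc
  have hcj : ∀ j, c ≤ w j * p j / (1 - p j) := fun j =>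
    Finset.inf'_le (fun j => w j * p j / (1 - p j)) (Finset.mem_univ j)
  have h2 : lamTot * c ≤ ∑ j, lam j * (w j * p j / (1 - p j)) := by
    rw [← hsum, Finset.sum_mul]
    exact Finset.sum_le_sum fun j _ => mul_le_mul_of_nonneg_left (hcj j) (hl j).le
  have h3 : ∑ j, w j * ((1 / (lam j) ^ 2 + p j) / (2 * (1 - p j) / lam j) + 1 / 2) =
      (1 / 2) * ∑ j, Real.sqrt (w j / (1 - p j)) ^ 2 / lam j +
      (1 / 2) * ∑ j, lam j * (w j * p j / (1 - p j)) + (1 / 2) * ∑ j, w j := by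
    rw [Finset.mul_sum, Finset.mul_sum, Finset.mul_sum, ← Finset.sum_add_distrib,
      ← Finset.sum_add_distrib]
    refine Finset.sum_congr rfl fun j _ => ?_
    have hq : 0 < 1 - p j := sub_pos.mpr (hp1 j)
    have hlj := (hl j).ne'
    have hq' := hq.ne'
    rw [Real.sq_sqrt (div_pos (hw j) hq).le]
    field_simp
  have h4 : (1 / (2 * lamTot)) * (∑ j, Real.sqrt (w j / (1 - p j))) ^ 2 =
      (1 / 2) * ((∑ j, Real.sqrt (w j / (1 - p j))) ^ 2 / lamTot) := by
    field_simp
  rw [h3, h4]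
  linarith
end

section
/- Fix an integer n_s ≥ 1, a decoding error probability q ∈ (0,1), and a user weight w > 0, and set E[S] = n_s/(1−q) and E[S²] = n_s²(1+q)/(1−q)². For every real δ ≥ n_s, the FR-HARQ Whittle index I^{FR}(δ) := ( w / (2·E[S]) ) · ( (δ + n_s q/(1−q))² + δ + n_s q/(1−q) − n_s² q/(1−q)² ) is the unique real number C such that L^{FR}(C, δ) = L^{FR}(C, δ+1), where L^{FR} is the average Lagrangian cost of the threshold policy. -/
/-- For code length `n_s ≥ 1`, decoding error probability `q ∈ (0,1)`,
weight `w > 0` and age `δ ≥ n_s`, the FR-HARQ Whittle index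
`I^{FR}(δ) = (w/(2·E[S]))·((δ + n_s q/(1−q))² + δ + n_s q/(1−q) − n_s² q/(1−q)²)`,
with `E[S] = n_s/(1−q)` and `E[S²] = n_s²(1+q)/(1−q)²`, is the unique cost `C` such that
the threshold-`δ` and threshold-`(δ+1)` policies have equal average Lagrangian cost
`L^{FR}(C,Γ) = w·((E[S²] + (Γ−n_s)·E[S])/(2((Γ−n_s)+E[S])) + (Γ+n_s)/2 − 1/2)
 + C·E[S]/((Γ−n_s)+E[S])`. -/
theorem fr_harq_whittle_index_unique_cost
    (ns : ℕ) (hns : 1 ≤ ns) (q w δ : ℝ) (hq0 : 0 < q) (hq1 : q < 1) (hw : 0 < w)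
    (hδ : (ns : ℝ) ≤ δ)
    (ES ES2 : ℝ) (hES : ES = (ns : ℝ) / (1 - q))
    (hES2 : ES2 = (ns : ℝ) ^ 2 * (1 + q) / (1 - q) ^ 2)
    (L : ℝ → ℝ → ℝ)
    (hL : ∀ C Γ : ℝ, L C Γ =
      w * ((ES2 + (Γ - (ns : ℝ)) * ES) / (2 * ((Γ - (ns : ℝ)) + ES))
            + (Γ + (ns : ℝ)) / 2 - 1 / 2)
        + C * ES / ((Γ - (ns : ℝ)) + ES)) :
    ∀ C : ℝ, L C δ = L C (δ + 1) ↔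
      C = (w / (2 * ES)) *
        ((δ + (ns : ℝ) * q / (1 - q)) ^ 2 + δ + (ns : ℝ) * q / (1 - q)
          - (ns : ℝ) ^ 2 * q / (1 - q) ^ 2) := by
  intro C
  have hn : (1:ℝ) ≤ (ns:ℝ) := by exact_mod_cast hns
  have h1 : 0 < 1 - q := by linarith
  have hE : 0 < ES := by rw [hES]; positivity
  obtain ⟨V, hV⟩ : ∃ V : ℝ, V = (ns:ℝ)^2 * q / (1-q)^2 := ⟨_, rfl⟩
  obtain ⟨D, hD⟩ : ∃ D : ℝ, D = δ + (ns:ℝ) * q / (1-q) := ⟨_, rfl⟩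
  have hDpos : 0 < D := by
    have : 0 < (ns:ℝ) * q / (1-q) := by positivity
    linarith
  have e1 : δ - (ns:ℝ) + ES = D := by
    rw [hD, hES]; field_simp; ring
  have e2 : ES2 = V + ES^2 := by
    rw [hES2, hV, hES]; field_simp; ring
  have hd : δ = D + (ns:ℝ) - ES := by linarith
  have key : L C δ - L C (δ+1) =
      (2 * ES * C - w * (D^2 + D - V)) / (2 * D * (D+1)) := by
    have e3 : δ + 1 - (ns:ℝ) + ES = D + 1 := by linarith
    have hD1 : D + 1 ≠ 0 := by positivity
    rw [hL, hL, e1, e3, e2, hd]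
    field_simp
    ring
  rw [← hV, add_assoc (_ ^ 2), ← hD, ← sub_eq_zero, key, div_eq_zero_iff]
  have hne : 2 * D * (D+1) ≠ 0 := by positivity
  simp only [hne, or_false]
  rw [div_mul_eq_mul_div, eq_div_iff (by positivity)]
  constructor <;> intro h <;> linarith
end

section
/- Let m₁ > 0 and m₂ be reals with m₂ ≥ m₁², and let n_s ≥ 1. Then both Γ ↦ J^Γ := ( m₂ + (Γ−n_s)·m₁ ) / ( 2( (Γ−n_s) + m₁ ) ) + (Γ+n_s)/2 − 1/2 and Γ ↦ C^Γ := m₁ / ( (Γ−n_s) + m₁ ) are convex functions of the real threshold Γ on the interval [n_s, ∞). -/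
theorem inv_aux (u v a b : ℝ) (hu : 0 < u) (hv : 0 < v) (ha : 0 ≤ a) (hb : 0 ≤ b)
    (hab : a + b = 1) : (a * u + b * v)⁻¹ ≤ a * u⁻¹ + b * v⁻¹ := by
  have h := (convexOn_zpow (𝕜 := ℝ) (-1)).2 (Set.mem_Ioi.2 hu) (Set.mem_Ioi.2 hv) ha hb hab
  simpa using h

/-- For `m₁ > 0`, `m₂ ≥ m₁²` and `n_s ≥ 1`, both the average AoI
`Γ ↦ J^Γ = (m₂ + (Γ−n_s)m₁)/(2((Γ−n_s)+m₁)) + (Γ+n_s)/2 − 1/2` and the average number of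
transmissions `Γ ↦ C^Γ = m₁/((Γ−n_s)+m₁)` are convex on `[n_s, ∞)`. -/
theorem fr_harq_threshold_convex
    (m₁ m₂ : ℝ) (hm₁ : 0 < m₁) (hm₂ : m₁ ^ 2 ≤ m₂) (ns : ℕ) (hns : 1 ≤ ns) :
    ConvexOn ℝ (Set.Ici ((ns : ℝ))) (fun Γ : ℝ =>
        (m₂ + (Γ - (ns : ℝ)) * m₁) / (2 * ((Γ - (ns : ℝ)) + m₁))
          + (Γ + (ns : ℝ)) / 2 - 1 / 2) ∧
      ConvexOn ℝ (Set.Ici ((ns : ℝ))) (fun Γ : ℝ =>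
        m₁ / ((Γ - (ns : ℝ)) + m₁)) := by
  have key : ∀ x y a b : ℝ, (ns : ℝ) ≤ x → (ns : ℝ) ≤ y → 0 ≤ a → 0 ≤ b → a + b = 1 →
      (a * x + b * y - ns + m₁)⁻¹ ≤ a * (x - ns + m₁)⁻¹ + b * (y - ns + m₁)⁻¹ := by
    intro x y a b hx hy ha hb hab
    have h := inv_aux (x - ns + m₁) (y - ns + m₁) a b (by linarith) (by linarith) ha hb hab
    have e : a * (x - ns + m₁) + b * (y - ns + m₁) = a * x + b * y - ns + m₁ := by
      linear_combination (m₁ - ns) * hab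
    rwa [e] at h
  have form : ∀ x : ℝ, (ns : ℝ) ≤ x →
      (m₂ + (x - (ns : ℝ)) * m₁) / (2 * ((x - (ns : ℝ)) + m₁)) + (x + (ns : ℝ)) / 2 - 1 / 2
        = m₁ / 2 + (m₂ - m₁ ^ 2) / 2 * (x - ns + m₁)⁻¹ + (x + (ns : ℝ)) / 2 - 1 / 2 := by
    intro x hx
    have : x - ns + m₁ ≠ 0 := by linarith
    field_simp
    ring
  refine ⟨⟨convex_Ici _, ?_⟩, ⟨convex_Ici _, ?_⟩⟩
  · intro x hx y hy a b ha hb hab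
    have hz := (convex_Ici (𝕜 := ℝ) (ns : ℝ)) hx hy ha hb hab
    simp only [Set.mem_Ici, smul_eq_mul] at *
    rw [form x hx, form y hy, form _ hz]
    have h := mul_le_mul_of_nonneg_left (key x y a b hx hy ha hb hab)
      (show 0 ≤ (m₂ - m₁ ^ 2) / 2 by linarith)
    obtain rfl : b = 1 - a := by linarith
    linarith
  · intro x hx y hy a b ha hb hab
    simp only [Set.mem_Ici, smul_eq_mul, div_eq_mul_inv] at *
    have h := mul_le_mul_of_nonneg_left (key x y a b hx hy ha hb hab) hm₁.le
    linarith
end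

section
/- Let M ≥ 1, let n_s ≥ 1 be an integer, let w₁,…,w_M > 0 be weights, let q₁,…,q_M ∈ (0,1) be decoding error probabilities, and let λ > 0. Set E[S_j] = n_s/(1−q_j) and Var(S_j) = n_s² q_j/(1−q_j)². For all positive reals λ₁,…,λ_M with λ₁+⋯+λ_M = λ, one has ∑_{j=1}^M w_j · ( E[S_j]/(2λ_j) + λ_j·Var(S_j)/(2·E[S_j]) + n_s − 1/2 ) ≥ (n_s/(2λ)) · ( ∑_{j=1}^M √( w_j/(1−q_j) ) )² + (λ n_s/2) · min_{1 ≤ j ≤ M} ( w_j q_j/(1−q_j) ) + ∑_{j=1}^M w_j·( n_s − 1/2 ). (This is the analytic core of the closed-form lower bound on the weighted average AoI for the multi-user FR-HARQ problem under an average transmission constraint.) -/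
open Finset

/-- Analytic core of the closed-form lower bound on the weighted average AoI
for the multi-user FR-HARQ problem under an average transmission constraint, with
`E[S_j] = n_s/(1−q_j)` and `Var(S_j) = n_s² q_j/(1−q_j)²`. -/
theorem fr_harq_aoi_lower_bound
    (m : ℕ) (ns : ℕ) (hns : 1 ≤ ns) (w q : Fin (m + 1) → ℝ) (lamTot : ℝ)
    (hw : ∀ j, 0 < w j) (hq0 : ∀ j, 0 < q j) (hq1 : ∀ j, q j < 1)
    (hlam : 0 < lamTot) :
    ∀ lam : Fin (m + 1) → ℝ, (∀ j, 0 < lam j) → (∑ j, lam j) = lamTot →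
      ∑ j, w j * (((ns : ℝ) / (1 - q j)) / (2 * lam j)
          + lam j * ((ns : ℝ) ^ 2 * q j / (1 - q j) ^ 2) / (2 * ((ns : ℝ) / (1 - q j)))
          + (ns : ℝ) - 1 / 2) ≥
        ((ns : ℝ) / (2 * lamTot)) * (∑ j, Real.sqrt (w j / (1 - q j))) ^ 2 +
          (lamTot * (ns : ℝ) / 2) *
            (Finset.univ.inf' Finset.univ_nonempty fun j => w j * q j / (1 - q j)) +
          ∑ j, w j * ((ns : ℝ) - 1 / 2) := by
  intro lam hl hsum
  have hn : (0 : ℝ) < ns := by exact_mod_cast hns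
  set I := Finset.univ.inf' Finset.univ_nonempty fun j => w j * q j / (1 - q j) with hI
  have h1 := Finset.sq_sum_div_le_sum_sq_div Finset.univ
    (fun j => Real.sqrt (w j / (1 - q j))) (g := lam) (fun j _ => hl j)
  rw [hsum] at h1
  have hrew : ∀ j, w j * (((ns : ℝ) / (1 - q j)) / (2 * lam j)
          + lam j * ((ns : ℝ) ^ 2 * q j / (1 - q j) ^ 2) / (2 * ((ns : ℝ) / (1 - q j)))
          + (ns : ℝ) - 1 / 2) = (ns / 2 : ℝ) * (Real.sqrt (w j / (1 - q j)) ^ 2 / lam j)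
          + (ns / 2 : ℝ) * (lam j * (w j * q j / (1 - q j))) + w j * ((ns : ℝ) - 1 / 2) := by
    intro j
    have hp : 0 < 1 - q j := by linarith [hq1 j]
    have hlj := hl j
    rw [Real.sq_sqrt (div_pos (hw j) hp).le]
    have := hp.ne'
    have := hlj.ne'
    have := hn.ne'
    field_simp
    ring
  rw [Finset.sum_congr rfl fun j _ => hrew j, Finset.sum_add_distrib, Finset.sum_add_distrib,
    ← Finset.mul_sum, ← Finset.mul_sum]
  have h2 : lamTot * I ≤ ∑ j, lam j * (w j * q j / (1 - q j)) := by
    rw [← hsum, Finset.sum_mul]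
    refine Finset.sum_le_sum fun j _ => mul_le_mul_of_nonneg_left ?_ (hl j).le
    exact Finset.inf'_le (fun j => w j * q j / (1 - q j)) (Finset.mem_univ j)
  have e1 : ((ns : ℝ) / (2 * lamTot)) * (∑ j, Real.sqrt (w j / (1 - q j))) ^ 2
      = (ns / 2 : ℝ) * ((∑ j, Real.sqrt (w j / (1 - q j))) ^ 2 / lamTot) := by
    field_simp
  have e2 : lamTot * (ns : ℝ) / 2 * I = (ns / 2 : ℝ) * (lamTot * I) := by ring
  rw [e1, e2]
  have a1 := mul_le_mul_of_nonneg_left h1 (half_pos hn).le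
  have a2 := mul_le_mul_of_nonneg_left h2 (half_pos hn).le
  linarith
end
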